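/- arXiv:1612.09179 — 3 statements merged into one kernel-verified Lean document; each statement's English description precedes it below -/
import Mathlib

section
/- Let α ∈ ℝ, let r : ℝ/ℤ → ℝ/ℤ be induced by a differentiable function ρ : ℝ → ℝ with ρ(x+1) − ρ(x) ∈ ℤ for all x, suppose r(x + 1/2) = 1 − r(x) (in ℝ/ℤ) for all x, and suppose the skew product homeomorphism F : 𝕋² → 𝕋², F(x,y) = (x + α, y + r(x)), is minimal. Let G : 𝕂 → 𝕂 be the (minimal) homeomorphism of the Klein bottle induced by F. Then there exist a continuous surjection H : 𝕂 → 𝕂 which is minimal and not injective, and an almost 1-1 factor map π : (𝕂, H) → (𝕂, G). -/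
open Function Set Topology Filter Metric

/-- A continuous map is minimal if every forward orbit `{f^n x : n ≥ 1}` is dense. -/
def IsMinimalMap {X : Type*} [TopologicalSpace X] (f : X → X) : Prop :=
  Continuous f ∧ ∀ x : X, Dense (Set.range fun n : ℕ => f^[n + 1] x)

/-- A space admits a minimal homeomorphism. -/
def AdmitsMinimalHomeo (X : Type*) [TopologicalSpace X] : Prop :=
  ∃ h : X ≃ₜ X, IsMinimalMap (h : X → X)

/-- Factor map between dynamical systems. -/
def IsFactorMap {X Y : Type*} [TopologicalSpace X] [TopologicalSpace Y]
    (π : X → Y) (f : X → X) (g : Y → Y) : Prop :=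
  Continuous π ∧ Function.Surjective π ∧ π ∘ f = g ∘ π

/-- A map is almost 1-1 if the set of points with singleton fiber is dense. -/
def IsAlmostOneOne {X Y : Type*} [TopologicalSpace X] [TopologicalSpace Y] (π : X → Y) : Prop :=
  Dense {y : Y | ∃! x : X, π x = y}

/-- The 2-torus `(ℝ/ℤ) × (ℝ/ℤ)`. -/
abbrev Torus2 : Type := AddCircle (1 : ℝ) × AddCircle (1 : ℝ)

/-- The generating relation for the Klein bottle: `(x, y) ∼ (x + 1/2, 1 - y)`. -/
def kleinRel : Torus2 → Torus2 → Prop :=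
  fun a b => b = (a.1 + (((1 : ℝ) / 2 : ℝ) : AddCircle (1 : ℝ)),
    (((1 : ℝ) : AddCircle (1 : ℝ))) - a.2)

/-- A continuous circle map which is a bounded perturbation of the identity is onto. -/
theorem surjective_add_coe {f : AddCircle (1 : ℝ) → ℝ} (hf : Continuous f) :
    Surjective fun b : AddCircle (1 : ℝ) => b + (f b : AddCircle (1 : ℝ)) := by
  obtain ⟨C, hC⟩ := (isCompact_range hf).isBounded.exists_norm_le
  have hC' : ∀ b, |f b| ≤ C := fun b => hC _ ⟨b, rfl⟩
  have hcont : Continuous fun u : ℝ => u + f (u : AddCircle (1 : ℝ)) :=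
    continuous_id.add (hf.comp (AddCircle.continuous_mk' 1))
  have hsurj : Surjective fun u : ℝ => u + f (u : AddCircle (1 : ℝ)) := by
    refine hcont.surjective ?_ ?_
    · exact tendsto_atTop_add_right_of_le _ (-C) tendsto_id fun u => (abs_le.mp (hC' _)).1
    · exact tendsto_atBot_add_right_of_ge _ C tendsto_id fun u => (abs_le.mp (hC' _)).2
  intro y
  obtain ⟨v, rfl⟩ := QuotientAddGroup.mk_surjective y
  obtain ⟨u, hu⟩ := hsurj v
  refine ⟨(u : AddCircle (1 : ℝ)), ?_⟩
  have := congrArg (fun w : ℝ => (w : AddCircle (1 : ℝ))) hu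
  simpa using this

/-- The norm of the class of a real number in the circle is at most its absolute value. -/
theorem norm_coe_le_abs (u : ℝ) : ‖(u : AddCircle (1 : ℝ))‖ ≤ |u| :=
  QuotientAddGroup.norm_mk_le_norm

/-- An odd `1`-Lipschitz function on the circle, equal to `b` for `b ∈ [-1/4, 1/4]`. -/
noncomputable def bump (b : AddCircle (1 : ℝ)) : ℝ :=
  (‖b + ((1 / 4 : ℝ) : AddCircle (1 : ℝ))‖ - ‖b - ((1 / 4 : ℝ) : AddCircle (1 : ℝ))‖) / 2

theorem continuous_bump : Continuous bump := by
  unfold bump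
  fun_prop

theorem bump_neg (b : AddCircle (1 : ℝ)) : bump (-b) = -bump b := by
  unfold bump
  rw [show -b + ((1 / 4 : ℝ) : AddCircle (1 : ℝ)) = -(b - ((1 / 4 : ℝ) : AddCircle (1 : ℝ))) by abel,
    show -b - ((1 / 4 : ℝ) : AddCircle (1 : ℝ)) = -(b + ((1 / 4 : ℝ) : AddCircle (1 : ℝ))) by abel,
    norm_neg, norm_neg]
  ring

theorem bump_zero : bump 0 = 0 := by
  have := bump_neg 0
  rw [neg_zero] at this
  linarith

/-- The class of `1/2` is at maximal distance from `0`. -/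
theorem norm_coe_half : ‖((1 / 2 : ℝ) : AddCircle (1 : ℝ))‖ = 1 / 2 := by
  simpa using AddCircle.norm_half_period_eq (1 : ℝ)

theorem bump_quarter : bump ((1 / 4 : ℝ) : AddCircle (1 : ℝ)) = 1 / 4 := by
  unfold bump
  rw [← AddCircle.coe_add, sub_self, norm_zero, show (1 / 4 + 1 / 4 : ℝ) = 1 / 2 by norm_num,
    norm_coe_half]
  norm_num

theorem abs_bump_sub_le (b c : AddCircle (1 : ℝ)) : |bump b - bump c| ≤ ‖b - c‖ := by
  have h1 := abs_norm_sub_norm_le (b + ((1 / 4 : ℝ) : AddCircle (1 : ℝ)))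
    (c + ((1 / 4 : ℝ) : AddCircle (1 : ℝ)))
  have h2 := abs_norm_sub_norm_le (b - ((1 / 4 : ℝ) : AddCircle (1 : ℝ)))
    (c - ((1 / 4 : ℝ) : AddCircle (1 : ℝ)))
  rw [add_sub_add_right_eq_sub] at h1
  rw [sub_sub_sub_cancel_right] at h2
  unfold bump
  rw [abs_le] at *
  constructor <;> linarith

theorem abs_bump_le (b : AddCircle (1 : ℝ)) : |bump b| ≤ 1 := by
  have h1 := AddCircle.norm_le_half_period (1 : ℝ) (x := b) one_ne_zero
  have h2 := abs_bump_sub_le b 0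
  rw [bump_zero, sub_zero, sub_zero] at h2
  rw [abs_one] at h1
  linarith

/-- A function on the circle with values in `[1/2, 1]`, equal to `1` exactly at `0` and `1/2`. -/
noncomputable def weight (x : AddCircle (1 : ℝ)) : ℝ := 1 - ‖x + x‖

theorem continuous_weight : Continuous weight := by
  unfold weight
  fun_prop

theorem weight_nonneg (x : AddCircle (1 : ℝ)) : 0 ≤ weight x := by
  have h1 := AddCircle.norm_le_half_period (1 : ℝ) (x := x + x) one_ne_zero
  rw [abs_one] at h1
  unfold weight
  linarith

theorem weight_le_one (x : AddCircle (1 : ℝ)) : weight x ≤ 1 := by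
  unfold weight
  linarith [norm_nonneg (x + x)]

theorem weight_lt_one {x : AddCircle (1 : ℝ)} (hx : x + x ≠ 0) : weight x < 1 := by
  unfold weight
  linarith [norm_pos_iff.mpr hx]

theorem coe_half_add_coe_half :
    ((1 / 2 : ℝ) : AddCircle (1 : ℝ)) + ((1 / 2 : ℝ) : AddCircle (1 : ℝ)) = 0 := by
  rw [← AddCircle.coe_add, add_halves, AddCircle.coe_period]

theorem weight_add_half (x : AddCircle (1 : ℝ)) :
    weight (x + (((1 : ℝ) / 2 : ℝ) : AddCircle (1 : ℝ))) = weight x := by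
  unfold weight
  rw [add_add_add_comm, coe_half_add_coe_half, add_zero]

/-- The fibrewise monotone map of the torus collapsing an arc over `0` and over `1/2`. -/
noncomputable def collapse (x b : AddCircle (1 : ℝ)) : AddCircle (1 : ℝ) :=
  b - ((weight x * bump b : ℝ) : AddCircle (1 : ℝ))

theorem continuous_collapse : Continuous fun z : Torus2 => collapse z.1 z.2 := by
  unfold collapse
  exact continuous_snd.sub ((AddCircle.continuous_mk' 1).comp
    ((continuous_weight.comp continuous_fst).mul (continuous_bump.comp continuous_snd)))

theorem collapse_surjective (x : AddCircle (1 : ℝ)) : Surjective (collapse x) := by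
  have h := surjective_add_coe (f := fun b => -(weight x * bump b))
    (continuous_const.mul continuous_bump).neg
  simp only [AddCircle.coe_neg, ← sub_eq_add_neg] at h
  exact h

theorem collapse_injective {x : AddCircle (1 : ℝ)} (hx : x + x ≠ 0) : Injective (collapse x) := by
  intro b c h
  have h1 : b - c = ((weight x * (bump b - bump c) : ℝ) : AddCircle (1 : ℝ)) := by
    unfold collapse at h
    rw [mul_sub, AddCircle.coe_sub, sub_eq_sub_iff_sub_eq_sub.mp h]
  have h2 : ‖b - c‖ ≤ weight x * ‖b - c‖ := by
    calc ‖b - c‖ = ‖((weight x * (bump b - bump c) : ℝ) : AddCircle (1 : ℝ))‖ := by rw [← h1]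
      _ ≤ |weight x * (bump b - bump c)| := norm_coe_le_abs _
      _ = weight x * |bump b - bump c| := by rw [abs_mul, abs_of_nonneg (weight_nonneg x)]
      _ ≤ weight x * ‖b - c‖ :=
        mul_le_mul_of_nonneg_left (abs_bump_sub_le b c) (weight_nonneg x)
  have h3 : ‖b - c‖ = 0 := by
    nlinarith [weight_lt_one hx, norm_nonneg (b - c)]
  exact sub_eq_zero.mp (norm_eq_zero.mp h3)

/-- The deck transformation of the torus over the Klein bottle. -/
noncomputable def deck (a : Torus2) : Torus2 :=
  (a.1 + (((1 : ℝ) / 2 : ℝ) : AddCircle (1 : ℝ)), -a.2)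

theorem deck_deck (a : Torus2) : deck (deck a) = a := by
  unfold deck
  ext
  · simp only [add_assoc, coe_half_add_coe_half, add_zero]
  · simp only [neg_neg]

theorem kleinRel_iff {a b : Torus2} : kleinRel a b ↔ b = deck a := by
  unfold kleinRel deck
  rw [AddCircle.coe_period, zero_sub]

theorem eqvGen_kleinRel_iff {a b : Torus2} :
    Relation.EqvGen kleinRel a b ↔ b = a ∨ b = deck a := by
  constructor
  · intro h
    induction h with
    | rel a b h => exact Or.inr (kleinRel_iff.mp h)
    | refl a => exact Or.inl rfl
    | symm a b _ ih =>
      rcases ih with rfl | rfl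
      · exact Or.inl rfl
      · exact Or.inr (deck_deck a).symm
    | trans a b c _ _ ih1 ih2 =>
      rcases ih1 with rfl | rfl
      · exact ih2
      · rcases ih2 with rfl | rfl
        · exact Or.inr rfl
        · exact Or.inl (deck_deck a)
  · rintro (rfl | rfl)
    · exact Relation.EqvGen.refl _
    · exact Relation.EqvGen.rel _ _ (kleinRel_iff.mpr rfl)

/-- A continuous self-map of a compact space which is semiconjugate to a minimal map, with a dense
set of points alone in their fibre, is minimal. -/
theorem isMinimalMap_of_dense_injectivity_points {Y X : Type*} [TopologicalSpace Y]
    [CompactSpace Y] [TopologicalSpace X] [T2Space X] {S : Y → Y} {F : X → X} {φ : Y → X}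
    (hS : Continuous S) (hφ : Continuous φ) (hsemi : Semiconj φ S F) (hF : IsMinimalMap F)
    (hdense : Dense {y : Y | ∀ y', φ y' = φ y → y' = y}) : IsMinimalMap S := by
  refine ⟨hS, fun y => ?_⟩
  have hclosed : IsClosed (φ '' closure (range fun n : ℕ => S^[n + 1] y)) :=
    (isClosed_closure.isCompact.image hφ).isClosed
  have hsub : (range fun n : ℕ => F^[n + 1] (φ y)) ⊆
      φ '' closure (range fun n : ℕ => S^[n + 1] y) := by
    rintro _ ⟨n, rfl⟩
    exact ⟨_, subset_closure ⟨n, rfl⟩, (hsemi.iterate_right (n + 1)).eq y⟩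
  have huniv : ∀ x, x ∈ φ '' closure (range fun n : ℕ => S^[n + 1] y) := fun x =>
    closure_minimal hsub hclosed (hF.2 (φ y) x)
  have hle : {y : Y | ∀ y', φ y' = φ y → y' = y} ⊆ closure (range fun n : ℕ => S^[n + 1] y) := by
    intro z hz
    obtain ⟨w, hw, hwz⟩ := huniv (φ z)
    rwa [hz w hwz] at hw
  exact dense_closure.mp (hdense.mono hle)

/-- A factor of a minimal map is minimal. -/
theorem IsMinimalMap.of_semiconj {Y X : Type*} [TopologicalSpace Y] [TopologicalSpace X]
    {S : Y → Y} {H : X → X} {φ : Y → X} (hS : IsMinimalMap S) (hH : Continuous H)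
    (hφ : Continuous φ) (hsurj : Surjective φ) (hsemi : Semiconj φ S H) : IsMinimalMap H := by
  refine ⟨hH, fun x => ?_⟩
  obtain ⟨y, rfl⟩ := hsurj x
  have h := hsurj.denseRange.dense_image hφ (hS.2 y)
  rw [← range_comp] at h
  convert h using 3 with n
  exact ((hsemi.iterate_right (n + 1)).eq y).symm

section SkewProduct

variable {F : Torus2 → Torus2} {α : ℝ} {r : AddCircle (1 : ℝ) → AddCircle (1 : ℝ)}

theorem iterate_skew_fst (hF : ∀ q, F q = (q.1 + (α : AddCircle (1 : ℝ)), q.2 + r q.1))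
    (n : ℕ) (q : Torus2) : (F^[n] q).1 = q.1 + n • (α : AddCircle (1 : ℝ)) := by
  induction n generalizing q with
  | zero => simp
  | succ n ih => rw [iterate_succ_apply, ih, hF, succ_nsmul', add_assoc]

theorem iterate_skew_snd_sub (hF : ∀ q, F q = (q.1 + (α : AddCircle (1 : ℝ)), q.2 + r q.1))
    (n : ℕ) {q q' : Torus2} (h : q'.1 = q.1) : (F^[n] q').2 - (F^[n] q).2 = q'.2 - q.2 := by
  induction n generalizing q q' with
  | zero => simp
  | succ n ih =>
    rw [iterate_succ_apply, iterate_succ_apply, ih (by rw [hF, hF, h]), hF, hF, h]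
    simp

/-- The base rotation of a minimal skew product has infinite order. -/
theorem nsmul_ne_zero_of_isMinimalMap
    (hF : ∀ q, F q = (q.1 + (α : AddCircle (1 : ℝ)), q.2 + r q.1)) (hmin : IsMinimalMap F)
    {k : ℕ} (hk : k ≠ 0) : k • (α : AddCircle (1 : ℝ)) ≠ 0 := by
  intro h0
  have hclosed : IsClosed {q : Torus2 | k • q.1 = 0} :=
    isClosed_eq ((continuous_nsmul k).comp continuous_fst) continuous_const
  have hsub : (range fun n : ℕ => F^[n + 1] (0, 0)) ⊆ {q : Torus2 | k • q.1 = 0} := by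
    rintro _ ⟨n, rfl⟩
    simp only [mem_ofPred_eq, iterate_skew_fst hF, zero_add]
    rw [smul_comm, h0, smul_zero]
  have hmem : ((((1 / 2 : ℝ) / k : ℝ) : AddCircle (1 : ℝ)), (0 : AddCircle (1 : ℝ))) ∈
      {q : Torus2 | k • q.1 = 0} := closure_minimal hsub hclosed (hmin.2 (0, 0) _)
  have hk' : (k : ℝ) ≠ 0 := Nat.cast_ne_zero.mpr hk
  have h1 : ((1 / 2 : ℝ) : AddCircle (1 : ℝ)) = 0 := by
    have : k • (((1 / 2 : ℝ) / k : ℝ) : AddCircle (1 : ℝ)) = 0 := hmem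
    rwa [← AddCircle.coe_nsmul, nsmul_eq_mul, mul_div_cancel₀ _ hk'] at this
  have h2 := norm_coe_half
  rw [h1, norm_zero] at h2
  norm_num at h2

/-- The base points whose forward orbit avoids `0` and `1/2`. -/
def regularBase (α : ℝ) : Set (AddCircle (1 : ℝ)) :=
  {x | ∀ n : ℕ, (x + n • (α : AddCircle (1 : ℝ))) + (x + n • (α : AddCircle (1 : ℝ))) ≠ 0}

theorem dense_regularBase
    (hF : ∀ q, F q = (q.1 + (α : AddCircle (1 : ℝ)), q.2 + r q.1)) (hmin : IsMinimalMap F) :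
    Dense (regularBase α) := by
  have h := Prod.fst_surjective.denseRange.dense_image continuous_fst (hmin.2 ((0, 0) : Torus2))
  refine h.mono ?_
  rintro _ ⟨_, ⟨n, rfl⟩, rfl⟩ m
  simp only [iterate_skew_fst hF, zero_add]
  rw [← add_nsmul, ← add_nsmul]
  exact nsmul_ne_zero_of_isMinimalMap hF hmin (by omega)

/-- The blow-up of the torus along the backward orbits of the two points `(0, 0)`, `(1/2, 0)`:
the fibre product of the maps `F^n` with the collapsing map. -/
def blowup (F : Torus2 → Torus2) : Set (Torus2 × (ℕ → AddCircle (1 : ℝ))) :=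
  {z | ∀ n, collapse (F^[n] z.1).1 (z.2 n) = (F^[n] z.1).2}

theorem isClosed_blowup (hFc : Continuous F) : IsClosed (blowup F) := by
  have h : blowup F = ⋂ n, {z | collapse (F^[n] z.1).1 (z.2 n) = (F^[n] z.1).2} := by
    ext z
    simp [blowup]
  rw [h]
  refine isClosed_iInter fun n => isClosed_eq ?_ ?_
  · exact continuous_collapse.comp (((continuous_fst.comp (hFc.iterate n)).comp
      continuous_fst).prodMk ((continuous_apply n).comp continuous_snd))
  · exact (continuous_snd.comp (hFc.iterate n)).comp continuous_fst

theorem exists_mem_blowup (q : Torus2) : ∃ b, (q, b) ∈ blowup F := by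
  choose b hb using fun n => collapse_surjective (F^[n] q).1 (F^[n] q).2
  exact ⟨b, hb⟩

theorem eq_of_mem_blowup_of_regular
    (hF : ∀ q, F q = (q.1 + (α : AddCircle (1 : ℝ)), q.2 + r q.1))
    {q : Torus2} (hq : q.1 ∈ regularBase α) {b c : ℕ → AddCircle (1 : ℝ)}
    (hb : (q, b) ∈ blowup F) (hc : (q, c) ∈ blowup F) : b = c := by
  funext n
  have hn := hq n
  rw [← iterate_skew_fst hF] at hn
  exact collapse_injective hn ((hb n).trans (hc n).symm)

/-- The vertical displacement in the identification of the blow-up with the torus. -/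
noncomputable def displacement (F : Torus2 → Torus2)
    (z : Torus2 × (ℕ → AddCircle (1 : ℝ))) : ℝ :=
  ∑' n : ℕ, (1 / 2 : ℝ) ^ (n + 1) * (weight (F^[n] z.1).1 * bump (z.2 n))

theorem summable_half_pow_succ : Summable fun n : ℕ => (1 / 2 : ℝ) ^ (n + 1) :=
  (summable_nat_add_iff 1).mpr summable_geometric_two

theorem tsum_half_pow_succ : ∑' n : ℕ, (1 / 2 : ℝ) ^ (n + 1) = 1 := by
  simp_rw [pow_succ, tsum_mul_right, tsum_geometric_two]
  norm_num

theorem abs_weight_mul_bump_le (x b : AddCircle (1 : ℝ)) : |weight x * bump b| ≤ 1 := by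
  rw [abs_mul, abs_of_nonneg (weight_nonneg x)]
  exact mul_le_one₀ (weight_le_one x) (abs_nonneg _) (abs_bump_le b)

theorem norm_displacement_term_le (n : ℕ) (x b : AddCircle (1 : ℝ)) :
    ‖(1 / 2 : ℝ) ^ (n + 1) * (weight x * bump b)‖ ≤ (1 / 2 : ℝ) ^ (n + 1) := by
  rw [norm_mul, Real.norm_of_nonneg (by positivity : (0 : ℝ) ≤ (1 / 2 : ℝ) ^ (n + 1))]
  exact mul_le_of_le_one_right (by positivity) (abs_weight_mul_bump_le x b)

theorem summable_displacement (z : Torus2 × (ℕ → AddCircle (1 : ℝ))) :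
    Summable fun n : ℕ => (1 / 2 : ℝ) ^ (n + 1) * (weight (F^[n] z.1).1 * bump (z.2 n)) :=
  Summable.of_norm_bounded summable_half_pow_succ fun n => norm_displacement_term_le n _ _

theorem continuous_displacement (hFc : Continuous F) : Continuous (displacement F) := by
  refine continuous_tsum (fun n => ?_) summable_half_pow_succ
    fun n z => norm_displacement_term_le n _ _
  refine continuous_const.mul (Continuous.mul ?_ ?_)
  · exact continuous_weight.comp ((continuous_fst.comp (hFc.iterate n)).comp continuous_fst)
  · exact continuous_bump.comp ((continuous_apply n).comp continuous_snd)

/-- The identification of the blow-up with the torus. -/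
noncomputable def toTorus (F : Torus2 → Torus2)
    (z : Torus2 × (ℕ → AddCircle (1 : ℝ))) : Torus2 :=
  (z.1.1, z.1.2 + (displacement F z : AddCircle (1 : ℝ)))

theorem continuous_toTorus (hFc : Continuous F) : Continuous (toTorus F) :=
  (continuous_fst.comp continuous_fst).prodMk ((continuous_snd.comp continuous_fst).add
    ((AddCircle.continuous_mk' 1).comp (continuous_displacement hFc)))

/-- If `h` is minus a weighted sum of the numbers `d n` of total weight one, and adding `h` does
not decrease their absolute values, then `h` vanishes. -/
theorem eq_zero_of_abs_le_abs_add {d : ℕ → ℝ} {h : ℝ}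
    (hs : Summable fun n : ℕ => (1 / 2 : ℝ) ^ (n + 1) * d n)
    (hsum : ∑' n : ℕ, (1 / 2 : ℝ) ^ (n + 1) * d n = -h) (hd : ∀ n, |d n| ≤ |h + d n|) :
    h = 0 := by
  have hsq : ∀ n, 0 ≤ h * (h + 2 * d n) := fun n => by
    have := sq_le_sq.mpr (hd n)
    nlinarith
  have hts : ∑' n : ℕ, (1 / 2 : ℝ) ^ (n + 1) * (h * (h + 2 * d n)) = -h ^ 2 := by
    have h1 : ∀ n : ℕ, (1 / 2 : ℝ) ^ (n + 1) * (h * (h + 2 * d n)) =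
        (1 / 2 : ℝ) ^ (n + 1) * h ^ 2 + (1 / 2 : ℝ) ^ (n + 1) * d n * (2 * h) := fun n => by ring
    simp_rw [h1]
    rw [(summable_half_pow_succ.mul_right _).tsum_add (hs.mul_right _), tsum_mul_right,
      tsum_mul_right, tsum_half_pow_succ, hsum]
    ring
  have hnn : 0 ≤ ∑' n : ℕ, (1 / 2 : ℝ) ^ (n + 1) * (h * (h + 2 * d n)) :=
    tsum_nonneg fun n => mul_nonneg (by positivity) (hsq n)
  rw [hts] at hnn
  nlinarith [sq_nonneg h]

theorem injOn_toTorus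
    (hF : ∀ q, F q = (q.1 + (α : AddCircle (1 : ℝ)), q.2 + r q.1)) (hmin : IsMinimalMap F) :
    InjOn (toTorus F) (blowup F) := by
  rintro ⟨q, b⟩ hb ⟨q', b'⟩ hb' heq
  obtain ⟨hx, hy⟩ := Prod.ext_iff.mp heq
  simp only [toTorus] at hx hy
  set d : ℕ → ℝ := fun n => weight (F^[n] q').1 * bump (b' n) - weight (F^[n] q).1 * bump (b n)
    with hd
  have hfst : ∀ n, (F^[n] q').1 = (F^[n] q).1 := fun n => by
    rw [iterate_skew_fst hF, iterate_skew_fst hF, hx]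
  have hsd : Summable fun n : ℕ => (1 / 2 : ℝ) ^ (n + 1) * d n := by
    simp_rw [hd, mul_sub]
    exact (summable_displacement (q', b')).sub (summable_displacement (q, b))
  have hsum : ∑' n : ℕ, (1 / 2 : ℝ) ^ (n + 1) * d n =
      displacement F (q', b') - displacement F (q, b) := by
    simp_rw [hd, mul_sub]
    exact (summable_displacement (q', b')).tsum_sub (summable_displacement (q, b))
  set h : ℝ := displacement F (q, b) - displacement F (q', b') with hh
  have hδ : q'.2 - q.2 = (h : AddCircle (1 : ℝ)) := by
    rw [hh, AddCircle.coe_sub, sub_eq_sub_iff_add_eq_add, add_comm _ q.2]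
    exact hy.symm
  have hbd : ∀ n, b' n - b n = ((h + d n : ℝ) : AddCircle (1 : ℝ)) := fun n => by
    have h1 := iterate_skew_snd_sub hF n hx.symm
    rw [← hb n, ← hb' n, hδ] at h1
    simp only [collapse] at h1
    rw [AddCircle.coe_add, ← h1, hd, AddCircle.coe_sub]
    abel
  have hlip : ∀ n, |d n| ≤ ‖b' n - b n‖ := fun n => by
    simp only [hd]
    rw [hfst n, ← mul_sub, abs_mul, abs_of_nonneg (weight_nonneg _)]
    exact (mul_le_of_le_one_left (abs_nonneg _) (weight_le_one _)).trans (abs_bump_sub_le _ _)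
  have h0 : h = 0 := eq_zero_of_abs_le_abs_add hsd (by rw [hsum, hh]; ring) fun n => by
    refine (hlip n).trans ?_
    rw [hbd n]
    exact norm_coe_le_abs _
  have hq : q' = q := by
    refine Prod.ext hx.symm (sub_eq_zero.mp ?_)
    rw [hδ, h0, AddCircle.coe_zero]
  subst hq
  have hreg : ∀ n, (F^[n] q').1 + (F^[n] q').1 ≠ 0 → d n = 0 := fun n hn => by
    have : b' n = b n := collapse_injective hn ((hb' n).trans (hb n).symm)
    simp only [hd]
    rw [this, sub_self]
  have hd0 : ∀ n, d n = 0 := by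
    intro n
    by_contra hne
    have hn : (F^[n] q').1 + (F^[n] q').1 = 0 := by
      by_contra hn
      exact hne (hreg n hn)
    have hother : ∀ m, m ≠ n → (1 / 2 : ℝ) ^ (m + 1) * d m = 0 := by
      intro m hmn
      rw [hreg m, mul_zero]
      intro hm
      rw [iterate_skew_fst hF] at hn hm
      have key : ∀ i j : ℕ, i < j →
          (q'.1 + i • (α : AddCircle (1 : ℝ))) + (q'.1 + i • (α : AddCircle (1 : ℝ))) = 0 →
          (q'.1 + j • (α : AddCircle (1 : ℝ))) + (q'.1 + j • (α : AddCircle (1 : ℝ))) = 0 →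
          False := by
        intro i j hij hi hj
        obtain ⟨k, rfl⟩ := Nat.exists_eq_add_of_lt hij
        refine nsmul_ne_zero_of_isMinimalMap hF hmin (k := (k + 1) + (k + 1)) (by omega) ?_
        rw [add_assoc i, add_nsmul _ i, ← add_assoc q'.1, add_add_add_comm, hi, zero_add] at hj
        rw [add_nsmul]
        exact hj
      rcases lt_or_gt_of_ne hmn with h | h
      · exact key _ _ h hm hn
      · exact key _ _ h hn hm
    rw [tsum_eq_single n hother] at hsum
    have : (1 / 2 : ℝ) ^ (n + 1) * d n = 0 := by
      rw [hsum]
      linarith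
    exact hne ((mul_eq_zero.mp this).resolve_left (by positivity))
  have hbb : b' = b := by
    funext n
    refine sub_eq_zero.mp ?_
    rw [hbd n, h0, hd0 n, add_zero, AddCircle.coe_zero]
  rw [hbb]

theorem exists_toTorus_eq_of_regular
    (hF : ∀ q, F q = (q.1 + (α : AddCircle (1 : ℝ)), q.2 + r q.1)) (hFc : Continuous F)
    {q : Torus2} (hq : q.1 ∈ regularBase α) : ∃ z ∈ blowup F, toTorus F z = q := by
  have hhomeo : ∀ n : ℕ, ∃ e : AddCircle (1 : ℝ) ≃ₜ AddCircle (1 : ℝ),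
      ∀ b, e b = collapse (q.1 + n • (α : AddCircle (1 : ℝ))) b := fun n =>
    ⟨(isHomeomorph_iff_continuous_bijective.mpr
      ⟨continuous_collapse.comp (continuous_const.prodMk continuous_id),
        collapse_injective (hq n), collapse_surjective _⟩).homeomorph _, fun _ => rfl⟩
  choose e he using hhomeo
  let s : AddCircle (1 : ℝ) → ℕ → AddCircle (1 : ℝ) := fun y n =>
    (e n).symm (F^[n] (q.1, y)).2
  have hsc : Continuous s := continuous_pi fun n =>
    (e n).symm.continuous.comp
      (continuous_snd.comp ((hFc.iterate n).comp (continuous_const.prodMk continuous_id)))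
  have hmem : ∀ y, ((q.1, y), s y) ∈ blowup F := by
    intro y n
    rw [iterate_skew_fst hF, ← he]
    exact (e n).apply_symm_apply _
  have hcont : Continuous fun y => displacement F ((q.1, y), s y) :=
    (continuous_displacement hFc).comp ((continuous_const.prodMk continuous_id).prodMk hsc)
  obtain ⟨y, hy⟩ := surjective_add_coe hcont q.2
  exact ⟨_, hmem y, Prod.ext rfl hy⟩

theorem dense_fst_mem_regularBase
    (hF : ∀ q, F q = (q.1 + (α : AddCircle (1 : ℝ)), q.2 + r q.1)) (hmin : IsMinimalMap F) :
    Dense {q : Torus2 | q.1 ∈ regularBase α} :=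
  (dense_regularBase hF hmin).preimage isOpenMap_fst

theorem exists_toTorus_eq
    (hF : ∀ q, F q = (q.1 + (α : AddCircle (1 : ℝ)), q.2 + r q.1)) (hmin : IsMinimalMap F)
    (q : Torus2) : ∃ z ∈ blowup F, toTorus F z = q := by
  have hclosed : IsClosed (toTorus F '' blowup F) :=
    ((isClosed_blowup hmin.1).isCompact.image (continuous_toTorus hmin.1)).isClosed
  exact closure_minimal (fun q hq => exists_toTorus_eq_of_regular hF hmin.1 hq) hclosed
    (dense_fst_mem_regularBase hF hmin q)

/-- The blow-up, identified with the torus. -/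
noncomputable def blowupHomeo
    (hF : ∀ q, F q = (q.1 + (α : AddCircle (1 : ℝ)), q.2 + r q.1)) (hmin : IsMinimalMap F) :
    blowup F ≃ₜ Torus2 :=
  haveI : CompactSpace (blowup F) := isCompact_iff_compactSpace.mp (isClosed_blowup hmin.1).isCompact
  IsHomeomorph.homeomorph (fun z : blowup F => toTorus F z)
    (isHomeomorph_iff_continuous_bijective.mpr
      ⟨(continuous_toTorus hmin.1).comp continuous_subtype_val,
        (injOn_toTorus hF hmin).injective, fun q => by
          obtain ⟨z, hz, h⟩ := exists_toTorus_eq hF hmin q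
          exact ⟨⟨z, hz⟩, h⟩⟩)

/-- The shift on the blow-up. -/
def blowupShift (F : Torus2 → Torus2) (z : blowup F) : blowup F :=
  ⟨(F z.1.1, fun n => z.1.2 (n + 1)), fun n => by
    have := z.2 (n + 1)
    rwa [iterate_succ_apply] at this⟩

theorem continuous_blowupShift (hFc : Continuous F) : Continuous (blowupShift F) := by
  refine Continuous.subtype_mk (Continuous.prodMk ?_ ?_) _
  · exact hFc.comp (continuous_fst.comp continuous_subtype_val)
  · exact continuous_pi fun n => (continuous_apply (n + 1)).comp
      (continuous_snd.comp continuous_subtype_val)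

theorem blowupShift_surjective (hFs : Surjective F) : Surjective (blowupShift F) := by
  rintro ⟨⟨q, b⟩, hb⟩
  obtain ⟨q, rfl⟩ := hFs q
  obtain ⟨c, hc⟩ := collapse_surjective q.1 q.2
  refine ⟨⟨(q, fun n => Nat.casesOn n c b), fun n => ?_⟩, rfl⟩
  cases n with
  | zero => exact hc
  | succ n => exact hb n

theorem isMinimalMap_blowupShift
    (hF : ∀ q, F q = (q.1 + (α : AddCircle (1 : ℝ)), q.2 + r q.1)) (hmin : IsMinimalMap F) :
    IsMinimalMap (blowupShift F) := by
  have : CompactSpace (blowup F) :=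
    isCompact_iff_compactSpace.mp (isClosed_blowup hmin.1).isCompact
  refine isMinimalMap_of_dense_injectivity_points (φ := fun z : blowup F => z.1.1)
    (continuous_blowupShift hmin.1) (continuous_fst.comp continuous_subtype_val)
    (fun z => rfl) hmin ?_
  have h := (dense_fst_mem_regularBase hF hmin).preimage (blowupHomeo hF hmin).isOpenMap
  refine h.mono ?_
  rintro ⟨⟨q, b⟩, hb⟩ hz ⟨⟨q', b'⟩, hb'⟩ (rfl : q' = q)
  have hz' : q'.1 ∈ regularBase α := hz
  have := eq_of_mem_blowup_of_regular hF hz' hb hb'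
  subst this
  rfl

/-- The lift of the deck transformation to the blow-up. -/
noncomputable def blowupDeck (hcomm : Function.Commute F deck) (z : blowup F) : blowup F :=
  ⟨(deck z.1.1, fun n => -z.1.2 n), fun n => by
    have h := z.2 n
    have hc : F^[n] (deck z.1.1) = deck (F^[n] z.1.1) := (hcomm.iterate_left n).eq z.1.1
    simp only [hc]
    simp only [deck, collapse, weight_add_half, bump_neg, mul_neg, AddCircle.coe_neg] at h ⊢
    rw [← h]
    abel⟩

theorem toTorus_blowupDeck (hcomm : Function.Commute F deck) (z : blowup F) :
    toTorus F (blowupDeck hcomm z) = deck (toTorus F z) := by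
  have hd : displacement F (blowupDeck hcomm z) = -displacement F z := by
    unfold displacement
    rw [← tsum_neg]
    refine tsum_congr fun n => ?_
    have hc : F^[n] (deck z.1.1) = deck (F^[n] z.1.1) := (hcomm.iterate_left n).eq z.1.1
    simp only [blowupDeck, hc]
    simp only [deck, weight_add_half, bump_neg]
    ring
  refine Prod.ext rfl ?_
  change -z.1.1.2 + (displacement F (blowupDeck hcomm z) : AddCircle (1 : ℝ)) =
    -(z.1.1.2 + (displacement F z : AddCircle (1 : ℝ)))
  rw [hd, AddCircle.coe_neg]
  abel

end SkewProduct

/-- For a minimal Parry-type skew product of the torus inducing a minimal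
homeomorphism `G` of the Klein bottle `K`, there is a minimal noninvertible map `H` of
`K` which is an almost 1-1 extension of `G`. -/
theorem stmt10 {K : Type*} [MetricSpace K] (p : Torus2 → K)
    (hquot : IsQuotientMap p)
    (hfib : ∀ a b : Torus2, p a = p b ↔ Relation.EqvGen kleinRel a b)
    (α : ℝ) (r : AddCircle (1 : ℝ) → AddCircle (1 : ℝ))
    (ρ : ℝ → ℝ) (hρ : Differentiable ℝ ρ)
    (hdeg : ∀ x : ℝ, ∃ n : ℤ, ρ (x + 1) - ρ x = (n : ℝ))
    (hr : ∀ x : ℝ, r (x : AddCircle (1 : ℝ)) = ((ρ x : ℝ) : AddCircle (1 : ℝ)))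
    (hsym : ∀ x : AddCircle (1 : ℝ),
      r (x + (((1 : ℝ) / 2 : ℝ) : AddCircle (1 : ℝ))) = (((1 : ℝ) : AddCircle (1 : ℝ))) - r x)
    (F : Torus2 ≃ₜ Torus2)
    (hF : ∀ q : Torus2, F q = (q.1 + ((α : ℝ) : AddCircle (1 : ℝ)), q.2 + r q.1))
    (hFmin : IsMinimalMap (F : Torus2 → Torus2))
    (G : K ≃ₜ K) (hG : ∀ a : Torus2, G (p a) = p (F a)) :
    ∃ H : K → K, Continuous H ∧ Function.Surjective H ∧ IsMinimalMap H ∧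
      ¬ Function.Injective H ∧
      ∃ π : K → K, IsFactorMap π H (G : K → K) ∧ IsAlmostOneOne π := by
  have hFc : Function.Commute (F : Torus2 → Torus2) deck := by
    intro q
    simp only [hF, deck]
    refine Prod.ext (add_right_comm _ _ _) ?_
    simp only [hsym, AddCircle.coe_period]
    abel
  have hp : ∀ a b, p a = p b ↔ b = a ∨ b = deck a := fun a b =>
    (hfib a b).trans eqvGen_kleinRel_iff
  let E := blowupHomeo hF hFmin
  have hEdeck : ∀ z, E (blowupDeck hFc z) = deck (E z) := toTorus_blowupDeck hFc
  have hP : IsQuotientMap (p ∘ E) := hquot.comp E.isQuotientMap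
  have hPeq : ∀ z w, (p ∘ E) z = (p ∘ E) w ↔ w = z ∨ w = blowupDeck hFc z := fun z w => by
    rw [comp_apply, comp_apply, hp, ← hEdeck, E.injective.eq_iff, E.injective.eq_iff]
  have hshift : ∀ z, blowupShift F (blowupDeck hFc z) = blowupDeck hFc (blowupShift F z) :=
    fun z => Subtype.ext (Prod.ext (hFc.eq z.1.1) rfl)
  obtain ⟨H, hHc, hH⟩ : ∃ H : K → K, Continuous H ∧
      ∀ z, H ((p ∘ E) z) = (p ∘ E) (blowupShift F z) := by
    have hf : ∀ z w, (p ∘ E) z = (p ∘ E) w →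
        (p ∘ E) (blowupShift F z) = (p ∘ E) (blowupShift F w) := by
      intro z w h
      rcases (hPeq z w).mp h with rfl | rfl
      · rfl
      · exact (hPeq _ _).mpr (Or.inr (hshift z))
    have hH : ∀ z, (p ∘ E) (blowupShift F (surjInv hP.surjective ((p ∘ E) z))) =
        (p ∘ E) (blowupShift F z) := fun z => hf _ _ (surjInv_eq hP.surjective _)
    refine ⟨fun k => (p ∘ E) (blowupShift F (surjInv hP.surjective k)), ?_, hH⟩
    exact hP.continuous_iff.mpr ((hP.continuous.comp
      (continuous_blowupShift hFmin.1)).congr fun z => (hH z).symm)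
  obtain ⟨π, hπc, hπ⟩ : ∃ π : K → K, Continuous π ∧ ∀ z, π ((p ∘ E) z) = p z.1.1 := by
    have hf : ∀ z w, (p ∘ E) z = (p ∘ E) w → p z.1.1 = p w.1.1 := by
      intro z w h
      rcases (hPeq z w).mp h with rfl | rfl
      · rfl
      · exact (hp _ _).mpr (Or.inr rfl)
    have hπ : ∀ z, p (surjInv hP.surjective ((p ∘ E) z)).1.1 = p z.1.1 :=
      fun z => hf _ _ (surjInv_eq hP.surjective _)
    refine ⟨fun k => p (surjInv hP.surjective k).1.1, ?_, hπ⟩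
    exact hP.continuous_iff.mpr ((hquot.continuous.comp
      (continuous_fst.comp continuous_subtype_val)).congr fun z => (hπ z).symm)
  have hsurj : Surjective H := by
    intro k
    obtain ⟨z, rfl⟩ := hP.surjective k
    obtain ⟨w, rfl⟩ := blowupShift_surjective F.surjective z
    exact ⟨_, hH w⟩
  refine ⟨H, hHc, hsurj, (isMinimalMap_blowupShift hF hFmin).of_semiconj hHc hP.continuous
    hP.surjective fun z => (hH z).symm, ?_, π, ⟨hπc, ?_, ?_⟩, ?_⟩
  · intro hinj
    obtain ⟨b, hb⟩ := exists_mem_blowup (F := F) (0, 0)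
    have hmem : ∀ c, collapse 0 c = 0 → ((0, 0), update b 0 c) ∈ blowup F := by
      intro c hc n
      cases n with
      | zero => simpa using hc
      | succ n => simpa using hb (n + 1)
    have hw : weight 0 = 1 := by simp [weight]
    let z : blowup F := ⟨_, hmem 0 (by simp [collapse, bump_zero])⟩
    let w : blowup F := ⟨_, hmem ((1 / 4 : ℝ) : AddCircle (1 : ℝ))
      (by rw [collapse, hw, bump_quarter, one_mul, sub_self])⟩
    have hzw : blowupShift F z = blowupShift F w :=
      Subtype.ext (Prod.ext rfl (funext fun n => by simp [blowupShift, z, w]))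
    have heq : (p ∘ E) z = (p ∘ E) w := hinj (by rw [hH, hH, hzw])
    rcases (hPeq z w).mp heq with h | h
    · have h1 : w.1.2 0 = z.1.2 0 := by rw [h]
      simp only [z, w, update_self] at h1
      have h2 := bump_quarter
      rw [h1, bump_zero] at h2
      norm_num at h2
    · have h1 : w.1.1.1 = (deck z.1.1).1 := by rw [h]; rfl
      simp only [z, w, deck, zero_add] at h1
      have h2 := norm_coe_half
      rw [← h1, norm_zero] at h2
      norm_num at h2
  · intro k
    obtain ⟨q, rfl⟩ := hquot.surjective k
    obtain ⟨b, hb⟩ := exists_mem_blowup (F := F) q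
    exact ⟨_, hπ ⟨_, hb⟩⟩
  · funext k
    obtain ⟨z, rfl⟩ := hP.surjective k
    rw [comp_apply, hH, hπ, comp_apply, hπ, hG]
    rfl
  · refine (hquot.surjective.denseRange.dense_image hquot.continuous
      (dense_fst_mem_regularBase hF hFmin)).mono ?_
    rintro _ ⟨q, hq, rfl⟩
    obtain ⟨b, hb⟩ := exists_mem_blowup (F := F) q
    have huniq : ∀ w : blowup F, w.1.1 = q → w = ⟨(q, b), hb⟩ := by
      rintro ⟨⟨q', c⟩, hc⟩ (rfl : q' = q)
      have := eq_of_mem_blowup_of_regular hF hq hb hc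
      subst this
      rfl
    refine ⟨(p ∘ E) ⟨(q, b), hb⟩, hπ _, fun k hk => ?_⟩
    obtain ⟨w, rfl⟩ := hP.surjective k
    rw [hπ, hp] at hk
    rcases hk with hk | hk
    · rw [huniq w hk.symm]
    · exact (hPeq _ _).mpr (Or.inr (huniq (blowupDeck hFc w) hk.symm).symm)
end

section
/- Let P be a nondegenerate continuum such that no nondegenerate subcontinuum of P is locally connected (for instance, a pseudo-arc). Then the product [0,1] × P contains no subspace homeomorphic to the square [0,1] × [0,1]. -/
open Function Set Topology Filter Metric

/-- A subcontinuum: a nonempty compact connected subset. -/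
def IsSubcontinuum {Y : Type*} [TopologicalSpace Y] (A : Set Y) : Prop :=
  IsCompact A ∧ IsConnected A

/-- The image of a compact locally connected space in a Hausdorff space is locally connected. -/
theorem Continuous.locallyConnectedSpace_range {X Y : Type*} [TopologicalSpace X] [CompactSpace X]
    [LocallyConnectedSpace X] [TopologicalSpace Y] [T2Space Y] {f : X → Y} (hf : Continuous f) :
    LocallyConnectedSpace (range f) :=
  (IsQuotientMap.of_surjective_continuous rangeFactorization_surjective
    hf.rangeFactorization).locallyConnectedSpace

instance unitInterval.locallyConnectedSpace : LocallyConnectedSpace unitInterval :=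
  have : LocallyPathConnectedSpace unitInterval := (convex_Icc (0 : ℝ) 1).locallyPathConnectedSpace
  inferInstance

/-- No continuous real-valued function on the unit square is injective: the diagonal and the
parabola join the same two corners, so both attain every intermediate value. -/
theorem not_injective_unitInterval_prod_real {f : unitInterval × unitInterval → ℝ}
    (hf : Continuous f) : ¬ Injective f := by
  intro hinj
  wlog hlt : f (0, 0) < f (1, 1) generalizing f
  · refine this (f := fun x ↦ -f x) hf.neg (neg_injective.comp hinj) (neg_lt_neg ?_)
    exact lt_of_le_of_ne (not_lt.mp hlt) fun h ↦ by simpa using hinj h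
  obtain ⟨t, h0, h1⟩ := exists_between hlt
  have hd : Continuous fun x : unitInterval ↦ f (x, x) := by fun_prop
  have hp : Continuous fun x : unitInterval ↦ f (x, x * x) := by fun_prop
  obtain ⟨x, hx⟩ := intermediate_value_univ 0 1 hd ⟨h0.le, h1.le⟩
  obtain ⟨y, hy⟩ := intermediate_value_univ 0 1 hp
    ⟨by simpa using h0.le, by simpa using h1.le⟩
  have hxy := hinj (hx.trans hy.symm)
  obtain ⟨rfl, hsq⟩ := Prod.mk.inj hxy
  have hsq' : (x : ℝ) * (1 - x) = 0 := by
    have h : (x : ℝ) = x * x := congrArg Subtype.val hsq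
    linarith
  rcases mul_eq_zero.mp hsq' with h | h
  · obtain rfl : x = 0 := Subtype.ext h
    exact h0.ne hx
  · obtain rfl : x = 1 := Subtype.ext (sub_eq_zero.mp h).symm
    exact h1.ne' hx

/-- If no nondegenerate subcontinuum of the nondegenerate continuum `P` is locally
connected, then `[0,1] × P` contains no copy of the square `[0,1] × [0,1]`. -/
theorem stmt12 {P : Type*} [MetricSpace P] [CompactSpace P] [ConnectedSpace P]
    [Nonempty P] (hP : Nontrivial P)
    (hnl : ∀ A : Set P, IsSubcontinuum A → ¬ A.Subsingleton → ¬ LocallyConnectedSpace A) :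
    ∀ A : Set (↥(Set.Icc (0 : ℝ) 1) × P),
      ¬ Nonempty (A ≃ₜ (↥(Set.Icc (0 : ℝ) 1) × ↥(Set.Icc (0 : ℝ) 1))) := by
  rintro A ⟨e⟩
  let g : unitInterval × unitInterval → P := fun x ↦ (e.symm x : unitInterval × P).2
  have hg : Continuous g := by fun_prop
  have hsub : (range g).Subsingleton := by
    by_contra h
    exact hnl (range g) ⟨isCompact_range hg, isConnected_range hg⟩ h hg.locallyConnectedSpace_range
  refine not_injective_unitInterval_prod_real
    (f := fun x ↦ ((e.symm x : unitInterval × P).1 : ℝ)) (by fun_prop) fun x y hxy ↦ ?_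
  exact e.symm.injective (Subtype.ext (Prod.ext (Subtype.ext hxy)
    (hsub (mem_range_self x) (mem_range_self y))))
end

section
/- Let X and Y be compact metric spaces, let f : X → X and g : Y → Y be continuous maps, and let π : (X,f) → (Y,g) be an almost 1-1 factor map. If f is minimal, then the set Y₁ = {y ∈ Y : π⁻¹(y) is a singleton} is residual in Y and its preimage π⁻¹(Y₁) is residual (in particular dense) in X. -/
open Function Set Topology Filter Metric

/-- A nonempty closed set covered by its own image under a minimal map is the whole space. -/
theorem IsMinimalMap.eq_univ_of_subset_image {X : Type*} [TopologicalSpace X] [CompactSpace X]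
    {f : X → X} (hf : IsMinimalMap f) {A : Set X} (hA : IsClosed A) (hne : A.Nonempty)
    (hsub : A ⊆ f '' A) : A = univ := by
  have hback : ∀ n : ℕ, ∀ x ∈ A, ∃ z, f^[n] z = x ∧ ∀ k ≤ n, f^[k] z ∈ A := by
    intro n
    induction n with
    | zero => exact fun x hx => ⟨x, rfl, fun k hk => by simpa [Nat.le_zero.mp hk] using hx⟩
    | succ n ih =>
      intro x hx
      obtain ⟨w, hw, rfl⟩ := hsub hx
      obtain ⟨z, rfl, hz⟩ := ih w hw
      refine ⟨z, iterate_succ_apply' f n z, fun k hk => ?_⟩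
      rcases Nat.le_succ_iff.mp hk with hk | rfl
      · exact hz k hk
      · rwa [iterate_succ_apply']
  obtain ⟨a, ha⟩ := hne
  obtain ⟨z, hz⟩ : (⋂ n : ℕ, ⋂ k ≤ n, f^[k] ⁻¹' A).Nonempty := by
    have hclosed (n : ℕ) : IsClosed (⋂ k ≤ n, f^[k] ⁻¹' A) :=
      isClosed_biInter fun k _ => hA.preimage (hf.1.iterate k)
    refine IsCompact.nonempty_iInter_of_sequence_nonempty_isCompact_isClosed _
      (fun n => biInter_mono (fun k hk => Nat.le_succ_of_le hk) fun _ _ => Subset.rfl)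
      (fun n => ?_) (hclosed 0).isCompact hclosed
    obtain ⟨z, -, hz⟩ := hback n a ha
    exact ⟨z, mem_iInter₂.mpr hz⟩
  have horb : range (fun n : ℕ => f^[n + 1] z) ⊆ A := by
    rintro _ ⟨n, rfl⟩
    exact mem_iInter₂.mp (mem_iInter.mp hz (n + 1)) (n + 1) le_rfl
  exact hA.closure_eq ▸ ((hf.2 z).mono horb).closure_eq

theorem IsMinimalMap.surjective {X : Type*} [TopologicalSpace X] [CompactSpace X] [T2Space X]
    {f : X → X} (hf : IsMinimalMap f) : Surjective f := by
  intro x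
  have horb : range (fun n : ℕ => f^[n + 1] x) ⊆ range f := by
    rintro _ ⟨n, rfl⟩
    exact ⟨f^[n] x, (iterate_succ_apply' f n x).symm⟩
  have hx : x ∈ closure (range f) := (hf.2 x).mono horb x
  rwa [(isCompact_range hf.1).isClosed.closure_eq] at hx

/-- The set of points with singleton fiber of a continuous surjection from a compact metric space
is a Gδ set. -/
theorem isGδ_setOf_existsUnique_eq {X Y : Type*} [MetricSpace X] [CompactSpace X]
    [TopologicalSpace Y] [T2Space Y] {π : X → Y} (hπ : Continuous π) (hsurj : Surjective π) :
    IsGδ {y : Y | ∃! x : X, π x = y} := by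
  let C (n : ℕ) : Set (X × X) := {p | π p.1 = π p.2 ∧ 1 / ((n : ℝ) + 1) ≤ dist p.1 p.2}
  have hC (n : ℕ) : IsClosed ((fun p : X × X => π p.1) '' C n) := by
    have hclosed : IsClosed (C n) :=
      
      (isClosed_eq (hπ.comp continuous_fst) (hπ.comp continuous_snd)).inter
        (isClosed_le continuous_const continuous_dist)
    exact (hclosed.isCompact.image (by fun_prop)).isClosed
  have heq : {y : Y | ∃! x : X, π x = y} = ⋂ n, ((fun p : X × X => π p.1) '' C n)ᶜ := by
    ext y
    simp only [mem_ofPred_eq, mem_iInter, mem_compl_iff]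
    constructor
    · rintro hy n ⟨⟨a, b⟩, ⟨hab, hd⟩, rfl⟩
      obtain rfl : a = b := hy.unique rfl hab.symm
      have hpos : (0 : ℝ) < 1 / ((n : ℝ) + 1) := Nat.one_div_pos_of_nat
      rw [dist_self] at hd
      exact hd.not_gt hpos
    · intro hy
      obtain ⟨a, rfl⟩ := hsurj y
      refine ⟨a, rfl, fun b hb => ?_⟩
      by_contra hne
      obtain ⟨n, hn⟩ := exists_nat_one_div_lt (dist_pos.mpr (Ne.symm hne))
      exact hy n ⟨(a, b), ⟨hb.symm, hn.le⟩, rfl⟩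
  rw [heq]
  exact .iInter_of_isOpen fun n => (hC n).isOpen_compl

/-- The points in singleton fibers of an almost 1-1 factor map out of a minimal system are
dense. -/
theorem IsFactorMap.dense_preimage_setOf_existsUnique {X Y : Type*} [TopologicalSpace X]
    [CompactSpace X] [T2Space X] [TopologicalSpace Y] [T2Space Y] {f : X → X} {g : Y → Y}
    {π : X → Y} (hfac : IsFactorMap π f g) (ha : IsAlmostOneOne π) (hmin : IsMinimalMap f) :
    Dense (π ⁻¹' {y : Y | ∃! x : X, π x = y}) := by
  obtain ⟨hπ, hsurj, hcomm⟩ := hfac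
  rcases isEmpty_or_nonempty X with hX | hX
  · exact fun x => isEmptyElim x
  have : Nonempty Y := hX.map π
  set P := π ⁻¹' {y : Y | ∃! x : X, π x = y} with hP
  have hleast : ∀ B : Set X, IsClosed B → π '' B = univ → closure P ⊆ B := by
    refine fun B hB hBY => closure_minimal (fun x hx => ?_) hB
    obtain ⟨b, hb, hbx⟩ : π x ∈ π '' B := hBY ▸ mem_univ _
    exact ExistsUnique.unique hx hbx rfl ▸ hb
  have himage : π '' closure P = univ := by
    rw [← univ_subset_iff, ← ha.closure_eq]
    refine closure_minimal ?_ (isClosed_closure.isCompact.image hπ).isClosed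
    rw [← image_preimage_eq {y : Y | ∃! x : X, π x = y} hsurj]
    exact image_mono subset_closure
  have hg : Surjective g := by
    refine Surjective.of_comp (g := π) ?_
    rw [← hcomm]
    exact hsurj.comp hmin.surjective
  have hne : (closure P).Nonempty := by
    rw [← image_nonempty (f := π), himage]
    exact univ_nonempty
  refine dense_iff_closure_eq.mpr (hmin.eq_univ_of_subset_image isClosed_closure hne
    (hleast _ (isClosed_closure.isCompact.image hmin.1).isClosed ?_))
  rw [← image_comp, hcomm, image_comp, himage, image_univ, hg.range_eq]

/-- For an almost 1-1 factor map out of a minimal system, the set of points with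
singleton fiber is residual, and so is its preimage. -/
theorem stmt19 {X Y : Type*} [MetricSpace X] [CompactSpace X]
    [MetricSpace Y] [CompactSpace Y]
    (f : X → X) (g : Y → Y) (hg : Continuous g)
    (π : X → Y) (hfac : IsFactorMap π f g) (ha : IsAlmostOneOne π)
    (hmin : IsMinimalMap f) :
    {y : Y | ∃! x : X, π x = y} ∈ residual Y ∧
    π ⁻¹' {y : Y | ∃! x : X, π x = y} ∈ residual X ∧
    Dense (π ⁻¹' {y : Y | ∃! x : X, π x = y}) := by
  have hGδ := isGδ_setOf_existsUnique_eq hfac.1 hfac.2.1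
  have hdense := hfac.dense_preimage_setOf_existsUnique ha hmin
  obtain ⟨U, hU, hUeq⟩ := isGδ_iff_eq_iInter_nat.mp hGδ
  have hGδ' : IsGδ (π ⁻¹' {y : Y | ∃! x : X, π x = y}) := by
    rw [hUeq, preimage_iInter]
    exact .iInter_of_isOpen fun n => (hU n).preimage hfac.1
  exact ⟨residual_of_dense_Gδ hGδ ha, residual_of_dense_Gδ hGδ' hdense, hdense⟩
end
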